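/- arXiv:2104.11264 — 2 statements merged into one kernel-verified Lean document; each statement's English description precedes it below -/
import Mathlib

section
/- Let K_1,…,K_r be d×d complex matrices with Σ_{j=1}^{r} K_j^† K_j = I_d, let D_1,…,D_r be d×d matrices and h a Hermitian r×r matrix such that Σ_{j=1}^{r} ( D̃_j^† K_j + K_j^† D̃_j ) = 0, and write α = Σ_j D̃_j^† D̃_j and β = Σ_j D̃_j^† K_j (so β^† = −β). For N ≥ 1 and k⃗ ∈ {1,…,r}^N define ∂̃K^⊗_{k⃗} = Σ_{i=1}^N K_{k_1} ⊗ ··· ⊗ K_{k_{i−1}} ⊗ D̃_{k_i} ⊗ K_{k_{i+1}} ⊗ ··· ⊗ K_{k_N}. Then the following exact identity holds: Σ_{k⃗ ∈ {1,…,r}^N} (∂̃K^⊗_{k⃗})^† (∂̃K^⊗_{k⃗}) = Σ_{i=1}^{N} I^{⊗(i−1)} ⊗ α ⊗ I^{⊗(N−i)} − Σ_{i ≠ j} (the N-fold Kronecker product with β in slot i, β in slot j, and I in all other slots), where the last sum runs over ordered pairs of distinct slots i, j ∈ {1,…,N}. -/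
open Matrix

/-- `D̃_j = D_j - i·Σ_k h_{jk}·K_k` -/
noncomputable def Dtilde {d r : ℕ} (K D : Fin r → Matrix (Fin d) (Fin d) ℂ)
    (h : Matrix (Fin r) (Fin r) ℂ) (j : Fin r) : Matrix (Fin d) (Fin d) ℂ :=
  D j - Complex.I • ∑ k, h j k • K k

/-- `α = Σ_j D̃_j† D̃_j` -/
noncomputable def alphaMat {d r : ℕ} (K D : Fin r → Matrix (Fin d) (Fin d) ℂ)
    (h : Matrix (Fin r) (Fin r) ℂ) : Matrix (Fin d) (Fin d) ℂ :=
  ∑ j, (Dtilde K D h j)ᴴ * Dtilde K D h j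

/-- `β = Σ_j D̃_j† K_j` -/
noncomputable def betaMat {d r : ℕ} (K D : Fin r → Matrix (Fin d) (Fin d) ℂ)
    (h : Matrix (Fin r) (Fin r) ℂ) : Matrix (Fin d) (Fin d) ℂ :=
  ∑ j, (Dtilde K D h j)ᴴ * K j

/-- The `N`-fold Kronecker (tensor) product `M 0 ⊗ M 1 ⊗ ⋯ ⊗ M (N-1)` of square matrices,
realized as a matrix indexed by tuples `Fin N → Fin d`. -/
noncomputable def tensorPow {d : ℕ} (N : ℕ) (M : Fin N → Matrix (Fin d) (Fin d) ℂ) :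
    Matrix (Fin N → Fin d) (Fin N → Fin d) ℂ :=
  Matrix.of fun a b => ∏ i, M i (a i) (b i)

/-- The parallel (tensor-product) derivative
`∂̃K^⊗_{k⃗} = Σ_{i=1}^N K_{k_1} ⊗ ⋯ ⊗ K_{k_{i-1}} ⊗ D̃_{k_i} ⊗ K_{k_{i+1}} ⊗ ⋯ ⊗ K_{k_N}`. -/
noncomputable def parDeriv {d r : ℕ} (K D : Fin r → Matrix (Fin d) (Fin d) ℂ)
    (h : Matrix (Fin r) (Fin r) ℂ) {N : ℕ} (k : Fin N → Fin r) :
    Matrix (Fin N → Fin d) (Fin N → Fin d) ℂ :=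
  ∑ i : Fin N, tensorPow N (fun j => if j = i then Dtilde K D h (k j) else K (k j))

theorem tensorPow_mul_tensorPow {d N : ℕ} (M M' : Fin N → Matrix (Fin d) (Fin d) ℂ) :
    tensorPow N M * tensorPow N M' = tensorPow N (fun s => M s * M' s) := by
  ext a b
  simp only [tensorPow, Matrix.mul_apply, Matrix.of_apply, ← Finset.prod_mul_distrib]
  rw [Finset.prod_univ_sum, Fintype.piFinset_univ]

theorem conjTranspose_tensorPow {d N : ℕ} (M : Fin N → Matrix (Fin d) (Fin d) ℂ) :
    (tensorPow N M)ᴴ = tensorPow N (fun s => (M s)ᴴ) := by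
  ext a b
  simp [tensorPow, Matrix.conjTranspose_apply]

theorem sum_tensorPow {d r N : ℕ} (F : Fin N → Fin r → Matrix (Fin d) (Fin d) ℂ) :
    ∑ k : Fin N → Fin r, tensorPow N (fun s => F s (k s)) =
      tensorPow N (fun s => ∑ j, F s j) := by
  ext a b
  simp only [tensorPow, Matrix.sum_apply, Matrix.of_apply]
  rw [Finset.prod_univ_sum, Fintype.piFinset_univ]

theorem tensorPow_eq_neg {d N : ℕ} (M M' : Fin N → Matrix (Fin d) (Fin d) ℂ) (j : Fin N)
    (hj : M j = -M' j) (hne : ∀ s, s ≠ j → M s = M' s) :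
    tensorPow N M = -tensorPow N M' := by
  ext a b
  simp only [tensorPow, Matrix.neg_apply, Matrix.of_apply]
  rw [← Finset.mul_prod_erase _ _ (Finset.mem_univ j),
    ← Finset.mul_prod_erase _ (fun i => M' i (a i) (b i)) (Finset.mem_univ j), hj,
    Matrix.neg_apply, neg_mul,
    Finset.prod_congr rfl fun s hs => by rw [hne s (Finset.ne_of_mem_erase hs)]]

/-- The exact identity for the parallel strategy: if `Σ_j (D̃_j† K_j + K_j† D̃_j) = 0`
(so `β† = −β`), then
`Σ_{k⃗} (∂̃K^⊗_{k⃗})† (∂̃K^⊗_{k⃗})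
  = Σ_i I^{⊗(i−1)} ⊗ α ⊗ I^{⊗(N−i)} − Σ_{i ≠ j} (β in slot i, β in slot j, I elsewhere)`,
the last sum running over ordered pairs of distinct slots. -/
theorem parallel_strategy_exact_identity {d r : ℕ}
    (K D : Fin r → Matrix (Fin d) (Fin d) ℂ)
    (hK : ∑ j, (K j)ᴴ * K j = 1)
    (h : Matrix (Fin r) (Fin r) ℂ) (hherm : h.IsHermitian)
    (hanti : ∑ j, ((Dtilde K D h j)ᴴ * K j + (K j)ᴴ * Dtilde K D h j) = 0)
    (N : ℕ) (hN : 0 < N) :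
    ∑ k : Fin N → Fin r, (parDeriv K D h k)ᴴ * parDeriv K D h k
      = (∑ i : Fin N, tensorPow N (fun s => if s = i then alphaMat K D h else 1))
        - ∑ i : Fin N, ∑ j : Fin N,
            if i = j then 0
            else tensorPow N (fun s =>
              if s = i then betaMat K D h else if s = j then betaMat K D h else 1) := by
  have hβ : ∑ j, (K j)ᴴ * Dtilde K D h j = -betaMat K D h := by
    rw [Finset.sum_add_distrib] at hanti
    exact eq_neg_of_add_eq_zero_right hanti
  have key (i j : Fin N) :
      ∑ k : Fin N → Fin r,
        (tensorPow N (fun s => if s = i then Dtilde K D h (k s) else K (k s)))ᴴ *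
          tensorPow N (fun s => if s = j then Dtilde K D h (k s) else K (k s)) =
      (if i = j then tensorPow N (fun s => if s = i then alphaMat K D h else 1) else 0) -
        if i = j then 0
        else tensorPow N (fun s =>
          if s = i then betaMat K D h else if s = j then betaMat K D h else 1) := by
    simp only [conjTranspose_tensorPow, tensorPow_mul_tensorPow]
    rw [sum_tensorPow fun s l => (if s = i then Dtilde K D h l else K l)ᴴ *
      (if s = j then Dtilde K D h l else K l)]
    split_ifs with hij
    · subst hij
      rw [sub_zero]
      congr 1
      funext s
      split_ifs
      · rfl
      · exact hK
    · rw [zero_sub]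
      refine tensorPow_eq_neg _ _ j ?_ fun s hs => ?_
      · simpa [Ne.symm hij] using hβ
      · simp only [if_neg hs]
        split_ifs
        · rfl
        · exact hK
  simp only [parDeriv, Matrix.conjTranspose_sum, Finset.sum_mul_sum]
  rw [Finset.sum_comm]
  simp_rw [Finset.sum_comm (s := (Finset.univ : Finset (Fin N → Fin r))), key,
    Finset.sum_sub_distrib]
  simp
end

section
/- Let v_1,…,v_r be nonzero, pairwise orthogonal vectors in ℂ^n, let p ≥ 1, and for each x ∈ {1,…,p} and i ∈ {1,…,r} let u_{x,i} ∈ ℂ^n. For vectors a, b ∈ ℂ^n write |a⟩⟨b| for the rank-one linear map y ↦ ⟨b, y⟩·a (inner product conjugate-linear in the first argument), and define the Hermitian operators D_x = Σ_{i=1}^r ( |u_{x,i}⟩⟨v_i| + |v_i⟩⟨u_{x,i}| ). Then the following are equivalent: (i) for every w ∈ ℂ^n orthogonal to all of v_1,…,v_r one has Σ_{x=1}^p D_x(D_x w) = 0; (ii) for every x and i, the vector u_{x,i} lies in the ℂ-linear span of {v_1,…,v_r}. (Equivalence of the finiteness condition for the RLD channel bound with local non-extremality of the channel.) -/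
open scoped InnerProductSpace

/-- The Hermitian operator `D_x = Σ_i (|u_{x,i}⟩⟨v_i| + |v_i⟩⟨u_{x,i}|)` applied to a vector:
`D_x y = Σ_i (⟨v_i, y⟩ • u_{x,i} + ⟨u_{x,i}, y⟩ • v_i)`. -/
noncomputable def rankOneSum {n r : ℕ} (v : Fin r → EuclideanSpace ℂ (Fin n))
    (u : Fin r → EuclideanSpace ℂ (Fin n)) (y : EuclideanSpace ℂ (Fin n)) :
    EuclideanSpace ℂ (Fin n) :=
  ∑ i, (⟪v i, y⟫_ℂ • u i + ⟪u i, y⟫_ℂ • v i)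

theorem inner_rankOneSum_left {n r : ℕ} (v u : Fin r → EuclideanSpace ℂ (Fin n))
    (y z : EuclideanSpace ℂ (Fin n)) :
    ⟪rankOneSum v u y, z⟫_ℂ = ⟪y, rankOneSum v u z⟫_ℂ := by
  simp only [rankOneSum, sum_inner, inner_sum, inner_add_left, inner_add_right, inner_smul_left,
    inner_smul_right, inner_conj_symm]
  exact Finset.sum_congr rfl fun i _ => by ring

theorem rankOneSum_of_inner_eq_zero {n r : ℕ} {v : Fin r → EuclideanSpace ℂ (Fin n)}
    (u : Fin r → EuclideanSpace ℂ (Fin n)) {w : EuclideanSpace ℂ (Fin n)}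
    (hw : ∀ i, ⟪v i, w⟫_ℂ = 0) : rankOneSum v u w = ∑ i, ⟪u i, w⟫_ℂ • v i := by
  simp [rankOneSum, hw]

theorem mem_orthogonal_span_range_iff {n r : ℕ} {v : Fin r → EuclideanSpace ℂ (Fin n)}
    {w : EuclideanSpace ℂ (Fin n)} :
    w ∈ (Submodule.span ℂ (Set.range v))ᗮ ↔ ∀ i, ⟪v i, w⟫_ℂ = 0 := by
  rw [← Submodule.span_singleton_le_iff_mem, ← Submodule.isOrtho_iff_le, Submodule.isOrtho_comm,
    Submodule.isOrtho_span]
  simp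

/-- Since each `D_x` is symmetric, the sum of the `D_x ^ 2` kills `w` only if every `D_x` does. -/
theorem rankOneSum_eq_zero_of_sum_eq_zero {n r p : ℕ} {v : Fin r → EuclideanSpace ℂ (Fin n)}
    {u : Fin p → Fin r → EuclideanSpace ℂ (Fin n)} {w : EuclideanSpace ℂ (Fin n)}
    (h : ∑ x, rankOneSum v (u x) (rankOneSum v (u x) w) = 0) (x : Fin p) :
    rankOneSum v (u x) w = 0 := by
  have hsum : ∑ x, ‖rankOneSum v (u x) w‖ ^ 2 = 0 := by
    have h' : ∑ x, ⟪rankOneSum v (u x) w, rankOneSum v (u x) w⟫_ℂ = 0 := by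
      simp_rw [inner_rankOneSum_left, ← inner_sum, h, inner_zero_right]
    simp_rw [inner_self_eq_norm_sq_to_K] at h'
    rw [← RCLike.ofReal_eq_zero (K := ℂ)]
    push_cast
    exact h'
  rw [Finset.sum_eq_zero_iff_of_nonneg fun _ _ => by positivity] at hsum
  simpa using hsum x (Finset.mem_univ x)

/-- Equivalence of the finiteness condition for the RLD channel bound with local
non-extremality: for nonzero pairwise orthogonal vectors `v_1, …, v_r` and vectors `u_{x,i}`,
with `D_x = Σ_i (|u_{x,i}⟩⟨v_i| + |v_i⟩⟨u_{x,i}|)`, the following are equivalent: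
(i) `Σ_x D_x (D_x w) = 0` for every `w` orthogonal to all `v_i`;
(ii) every `u_{x,i}` lies in the span of `{v_1, …, v_r}`. -/
theorem RLD_finiteness_iff_local_nonextremality {n r p : ℕ} (hp : 0 < p)
    (v : Fin r → EuclideanSpace ℂ (Fin n)) (hv : ∀ i, v i ≠ 0)
    (horth : ∀ i j, i ≠ j → ⟪v i, v j⟫_ℂ = 0)
    (u : Fin p → Fin r → EuclideanSpace ℂ (Fin n)) :
    (∀ w : EuclideanSpace ℂ (Fin n), (∀ i, ⟪v i, w⟫_ℂ = 0) →
        ∑ x, rankOneSum v (u x) (rankOneSum v (u x) w) = 0)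
      ↔ (∀ x i, u x i ∈ Submodule.span ℂ (Set.range v)) := by
  constructor
  · intro h x i
    rw [← Submodule.orthogonal_orthogonal (Submodule.span ℂ (Set.range v)),
      Submodule.mem_orthogonal']
    intro w hw
    rw [mem_orthogonal_span_range_iff] at hw
    have hD := rankOneSum_eq_zero_of_sum_eq_zero (h w hw) x
    rw [rankOneSum_of_inner_eq_zero _ hw] at hD
    exact Fintype.linearIndependent_iff.1
      (linearIndependent_of_ne_zero_of_inner_eq_zero hv horth) _ hD i
  · intro h w hw
    refine Finset.sum_eq_zero fun x _ => ?_
    have hD : rankOneSum v (u x) w = 0 := by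
      rw [rankOneSum_of_inner_eq_zero _ hw]
      refine Finset.sum_eq_zero fun i _ => ?_
      rw [Submodule.inner_right_of_mem_orthogonal (h x i) (mem_orthogonal_span_range_iff.2 hw),
        zero_smul]
    rw [hD]
    simp [rankOneSum]
end
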